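/- arXiv:2410.09980 — 2 statements merged into one kernel-verified Lean document; each statement's English description precedes it below -/
import Mathlib

section
/- Let n ≥ 2 be a real number, let k be a positive integer with k ≥ 8 ln n, and let s_0, s_1, …, s_k be positive real numbers with s_0 ≥ 1 and Σ_{i=0}^k s_i ≤ n. Let E_1, …, E_k be mutually independent events on a probability space such that P[E_i] ≤ min{1, s_i / Σ_{j=0}^{i−1} s_j} for each i ∈ {1,…,k}. Then P[⋂_{i=1}^k E_i] ≤ 1/n². -/
open MeasureTheory

/-- A product of the increment ratios `s (i + 1) / ∑ j ≤ i, s j` is bounded by the squared total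
growth of the partial sums, up to a factor `4 ^ k`. -/
theorem prod_div_partial_sum_le (s : ℕ → ℝ) (k : ℕ) (hpos : ∀ i ≤ k, 0 < s i) :
    ∏ i ∈ Finset.range k, (s (i + 1) / ∑ j ∈ Finset.range (i + 1), s j) ≤
      ((∑ j ∈ Finset.range (k + 1), s j) / s 0) ^ 2 / 4 ^ k := by
  induction k with
  | zero =>
    have h0 := (hpos 0 le_rfl).ne'
    simp [h0]
  | succ k ih =>
    have h := ih fun i hi => hpos i (by omega)
    have hS : 0 < ∑ j ∈ Finset.range (k + 1), s j :=
      Finset.sum_pos (fun i hi => hpos i (by have := Finset.mem_range.1 hi; omega)) (by simp)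
    have hs := hpos (k + 1) le_rfl
    have h0 := hpos 0 (Nat.zero_le _)
    rw [Finset.prod_range_succ, Finset.sum_range_succ _ (k + 1)]
    set S := ∑ j ∈ Finset.range (k + 1), s j
    calc _ ≤ (S / s 0) ^ 2 / 4 ^ k * (s (k + 1) / S) := by gcongr
      _ = 4 * (S * s (k + 1)) / (s 0 ^ 2 * 4 ^ (k + 1)) := by
        field_simp
        ring
      _ ≤ (S + s (k + 1)) ^ 2 / (s 0 ^ 2 * 4 ^ (k + 1)) := by
        gcongr
        nlinarith [sq_nonneg (S - s (k + 1))]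
      _ = _ := by
        field_simp

/-- If `k ≥ 8 log n` then `n ^ 4 ≤ 4 ^ k`. -/
theorem pow_four_le_four_pow {n : ℝ} (hn : 1 ≤ n) {k : ℕ} (hkn : 8 * Real.log n ≤ k) :
    n ^ 4 ≤ 4 ^ k := by
  have hl := Real.log_nonneg hn
  calc n ^ 4 = Real.exp (4 * Real.log n) := by
        rw [← Real.exp_log (by linarith : 0 < n), ← Real.exp_nat_mul, Real.log_exp]
        norm_num
    _ ≤ Real.exp (k * 1) := Real.exp_le_exp.2 (by linarith)
    _ = Real.exp 1 ^ k := Real.exp_nat_mul _ _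
    _ ≤ 4 ^ k := by
      gcongr
      linarith [Real.exp_one_lt_d9]

/-- Let `n ≥ 2`, `k ≥ 8 ln n`, and `s_0, …, s_k > 0` with `s_0 ≥ 1` and
`Σ_{i=0}^k s_i ≤ n`. If `E_1, …, E_k` are mutually independent events with
`P[E_i] ≤ min{1, s_i / Σ_{j<i} s_j}` (here `i : Fin k` stands for index `i+1`),
then `P[⋂ E_i] ≤ 1/n²`. -/
theorem stmt_7 {Ω : Type*} [MeasurableSpace Ω] (μ : Measure Ω) [IsProbabilityMeasure μ]
    (n : ℝ) (hn : 2 ≤ n) (k : ℕ) (hk : 1 ≤ k) (hkn : 8 * Real.log n ≤ k)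
    (s : ℕ → ℝ) (hpos : ∀ i ≤ k, 0 < s i) (hs0 : 1 ≤ s 0)
    (hsum : ∑ i ∈ Finset.range (k + 1), s i ≤ n)
    (E : Fin k → Set Ω) (hEmeas : ∀ i, MeasurableSet (E i))
    (hind : ProbabilityTheory.iIndepSet E μ)
    (hP : ∀ i : Fin k,
      μ (E i) ≤ ENNReal.ofReal
        (min 1 (s ((i : ℕ) + 1) / ∑ j ∈ Finset.range ((i : ℕ) + 1), s j))) :
    μ (⋂ i, E i) ≤ ENNReal.ofReal (1 / n ^ 2) := by
  have hSpos : ∀ i ≤ k, 0 < ∑ j ∈ Finset.range (i + 1), s j := fun i hi =>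
    Finset.sum_pos (fun j hj => hpos j (by have := Finset.mem_range.1 hj; omega)) (by simp)
  have hr : ∀ i < k, 0 ≤ s (i + 1) / ∑ j ∈ Finset.range (i + 1), s j := fun i hi =>
    (div_pos (hpos _ hi) (hSpos i hi.le)).le
  have hprod : μ (⋂ i, E i) = ∏ i, μ (E i) := by
    simpa using ((ProbabilityTheory.iIndepSet_iff_meas_biInter hEmeas).1 hind) Finset.univ
  calc μ (⋂ i, E i) = ∏ i, μ (E i) := hprod
    _ ≤ ∏ i : Fin k, ENNReal.ofReal
        (s ((i : ℕ) + 1) / ∑ j ∈ Finset.range ((i : ℕ) + 1), s j) :=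
      Finset.prod_le_prod' fun i _ =>
        (hP i).trans (ENNReal.ofReal_le_ofReal (min_le_right _ _))
    _ = ENNReal.ofReal (∏ i ∈ Finset.range k,
        (s (i + 1) / ∑ j ∈ Finset.range (i + 1), s j)) := by
      rw [← Fin.prod_univ_eq_prod_range
          fun i => s (i + 1) / ∑ j ∈ Finset.range (i + 1), s j,
        ENNReal.ofReal_prod_of_nonneg fun (i : Fin k) _ => hr i i.2]
    _ ≤ ENNReal.ofReal (1 / n ^ 2) := by
      refine ENNReal.ofReal_le_ofReal ((prod_div_partial_sum_le s k hpos).trans ?_)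
      have hS := hSpos k le_rfl
      have hSn : (∑ j ∈ Finset.range (k + 1), s j) / s 0 ≤ n :=
        (div_le_self hS.le hs0).trans hsum
      have hn4 := pow_four_le_four_pow (by linarith : 1 ≤ n) hkn
      calc _ ≤ n ^ 2 / n ^ 4 := by gcongr
        _ = 1 / n ^ 2 := by field_simp
end

section
/- Let G be a finite simple graph and let p be a walk in G such that (i) every edge appears at most twice in the edge sequence of p, and (ii) the set of edges traversed by p contains no cycle of G (i.e., these edges form a forest). Then the number of distinct vertices visited by p is at least length(p)/2 + 1. -/
namespace SimpleGraph.Walk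

/-- A walk whose edges form a forest visits more vertices than it traverses distinct edges. -/
theorem card_edges_toFinset_lt_card_support_toFinset {V : Type*} [DecidableEq V]
    {G : SimpleGraph V} {u v : V} (p : G.Walk u v)
    (hp : (fromEdgeSet {e : Sym2 V | e ∈ p.edges}).IsAcyclic) :
    p.edges.toFinset.card < p.support.toFinset.card := by
  induction p with
  | nil => simp
  | @cons u w v h p ih =>
    have ih := ih (hp.anti (fromEdgeSet_mono fun e he ↦ by simp_all))
    rw [edges_cons, support_cons, List.toFinset_cons, List.toFinset_cons]
    by_cases he : s(u, w) ∈ p.edges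
    · rw [Finset.insert_eq_of_mem (by simpa using he)]
      exact ih.trans_le (Finset.card_le_card (Finset.subset_insert _ _))
    · have hu : u ∉ p.support := by
        intro hu
        have hadj : (fromEdgeSet {e : Sym2 V | e ∈ (cons h p).edges}).Adj u w := by
          simp [h.ne]
        have hbridge := isAcyclic_iff_forall_adj_isBridge.mp hp hadj
        rw [isBridge_iff_forall_walk_mem_edges] at hbridge
        have hsub : ∀ e ∈ (p.takeUntil u hu).reverse.edges,
            e ∈ (fromEdgeSet {e : Sym2 V | e ∈ (cons h p).edges}).edgeSet := by
          intro e hq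
          have hq' : e ∈ p.edges := p.edges_takeUntil_subset_edges hu (by simpa using hq)
          simpa [edgeSet_fromEdgeSet, hq'] using
            G.not_isDiag_of_mem_edgeSet (p.edges_subset_edgeSet hq')
        have hmem := hbridge ((p.takeUntil u hu).reverse.transfer _ hsub)
        rw [edges_transfer, edges_reverse, List.mem_reverse] at hmem
        exact he (p.edges_takeUntil_subset_edges hu hmem)
      rw [Finset.card_insert_of_notMem (by simpa using he),
        Finset.card_insert_of_notMem (by simpa using hu)]
      exact Nat.succ_lt_succ ih

/-- A walk crossing each edge at most `n` times has length at most `n` times the number of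
distinct edges it traverses. -/
theorem length_le_mul_card_edges_toFinset {V : Type*} [DecidableEq V]
    {G : SimpleGraph V} {u v : V} (p : G.Walk u v) {n : ℕ}
    (hn : ∀ e : Sym2 V, p.edges.count e ≤ n) :
    p.length ≤ n * p.edges.toFinset.card := by
  rw [← p.length_edges, ← List.sum_toFinset_count_eq_length, mul_comm, ← smul_eq_mul]
  exact Finset.sum_le_card_nsmul _ _ _ fun e _ ↦ hn e

end SimpleGraph.Walk

/-- If `p` is a walk in a simple graph `G` such that (i) every edge appears at
most twice in the edge sequence of `p`, and (ii) the set of edges traversed by `p` contains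
no cycle (i.e., these edges form a forest), then the number of distinct vertices visited by
`p` is at least `length(p)/2 + 1`. -/
theorem stmt_9 {V : Type*} [DecidableEq V] (G : SimpleGraph V) {u v : V} (p : G.Walk u v)
    (h2 : ∀ e : Sym2 V, p.edges.count e ≤ 2)
    (hforest : (SimpleGraph.fromEdgeSet {e : Sym2 V | e ∈ p.edges}).IsAcyclic) :
    (p.length : ℝ) / 2 + 1 ≤ (p.support.toFinset.card : ℝ) := by
  have hlt := p.card_edges_toFinset_lt_card_support_toFinset hforest
  have hle := p.length_le_mul_card_edges_toFinset h2
  have h : p.length + 2 ≤ 2 * p.support.toFinset.card := by omega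
  have h' : (p.length : ℝ) + 2 ≤ 2 * (p.support.toFinset.card : ℝ) := by exact_mod_cast h
  linarith
end
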